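/- Let X/S be a smooth configuration scheme and α ∈ S. Let i: {α} ↪ U_α and j: U_α ↪ S be the closed and open embeddings. Then the composition j_! ∘ i_*: D^b(coh(X(α))) → D^b(coh(X/S)) is fully faithful; in particular D^b(coh(X(α))) is naturally a full subcategory of D^b(coh(X/S)). -/

import Mathlib

open CategoryTheory CategoryTheory.Limits

universe w v u

/-- A diagram of categories indexed by a poset `S`: for `β ≤ α`, a transition functor
`φ : C α ⥤ C β`, strictly functorial. -/
structure PosetDiagram (S : Type) [PartialOrder S] where
  C : S → Type u
  cat : ∀ α, Category.{v} (C α)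
  φ : ∀ {α β : S}, β ≤ α → (C α ⥤ C β)
  φ_refl : ∀ α, φ (le_refl α) = 𝟭 (C α)
  φ_trans : ∀ {α β γ : S} (h₁ : β ≤ α) (h₂ : γ ≤ β), φ (h₂.trans h₁) = φ h₁ ⋙ φ h₂

attribute [instance] PosetDiagram.cat

variable {S : Type} [PartialOrder S]

/-- Objects of the poset category `M(S,C)`. -/
structure ConfObj (D : PosetDiagram S) where
  F : ∀ α, D.C α
  σ : ∀ {α β : S} (h : β ≤ α), (D.φ h).obj (F α) ⟶ F β
  σ_refl : ∀ α, σ (le_refl α) = eqToHom (by rw [D.φ_refl]; rfl)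
  σ_trans : ∀ {α β γ : S} (h₁ : β ≤ α) (h₂ : γ ≤ β),
      σ (h₂.trans h₁) = eqToHom (by rw [D.φ_trans h₁ h₂]; rfl) ≫ (D.φ h₂).map (σ h₁) ≫ σ h₂

/-- Morphisms in the poset category `M(S,C)`. -/
@[ext]
structure ConfHom {D : PosetDiagram S} (F G : ConfObj D) where
  f : ∀ α, F.F α ⟶ G.F α
  comm : ∀ {α β : S} (h : β ≤ α), (D.φ h).map (f α) ≫ G.σ h = F.σ h ≫ f β

/-- The poset category `M(S,C)`. -/
instance confCategory (D : PosetDiagram S) : Category (ConfObj D) where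
  Hom F G := ConfHom F G
  id F := ⟨fun _ => 𝟙 _, by intro α β h; simp⟩
  comp u v := ⟨fun α => u.f α ≫ v.f α, by
    intro α β h
    rw [Functor.map_comp, Category.assoc, v.comm h, ← Category.assoc, u.comm h, Category.assoc]⟩
  id_comp u := by apply ConfHom.ext; funext α; exact Category.id_comp _
  comp_id u := by apply ConfHom.ext; funext α; exact Category.comp_id _
  assoc u v w := by apply ConfHom.ext; funext α; exact Category.assoc _ _ _

@[simp] lemma conf_id_f (D : PosetDiagram S) (F : ConfObj D) (α : S) :
    (𝟙 F : ConfHom F F).f α = 𝟙 (F.F α) := rfl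

@[simp] lemma conf_comp_f (D : PosetDiagram S) {F G H : ConfObj D} (u : F ⟶ G) (v : G ⟶ H)
    (α : S) : (u ≫ v).f α = u.f α ≫ v.f α := rfl

/-- The evaluation functor `j_α^* : M(S,C) ⥤ C(α)`. -/
def evalF (D : PosetDiagram S) (α : S) : ConfObj D ⥤ D.C α where
  obj F := F.F α
  map u := u.f α

/-- Restriction of a poset diagram to a subset of the poset. -/
def PosetDiagram.restrict (D : PosetDiagram S) (T : Set S) : PosetDiagram T where
  C t := D.C t.1
  cat t := D.cat t.1
  φ h := D.φ h
  φ_refl t := D.φ_refl t.1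
  φ_trans h₁ h₂ := D.φ_trans h₁ h₂

/-- The restriction functor `M(S,C) ⥤ M(T, C|_T)`. -/
def resF (D : PosetDiagram S) (T : Set S) : ConfObj D ⥤ ConfObj (D.restrict T) where
  obj F :=
    { F := fun t => F.F t.1
      σ := fun h => F.σ h
      σ_refl := fun t => F.σ_refl t.1
      σ_trans := fun h₁ h₂ => F.σ_trans h₁ h₂ }
  map u :=
    { f := fun t => u.f t.1
      comm := fun h => u.comm h }

/-- `F` is supported in `T` if all components outside of `T` vanish. -/
def SuppIn {D : PosetDiagram S} (F : ConfObj D) (T : Set S) : Prop :=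
  ∀ α, α ∉ T → IsZero (F.F α)
open AlgebraicGeometry

universe u_1

/-! ### Coherent sheaf data

Mathlib does not yet have the category of coherent sheaves on a scheme, so we axiomatize,
as a structure, the assignment to every scheme `X` of its abelian category `coh X` of
coherent sheaves, together with the (right exact) inverse image functors `f^*`, the
structure sheaves `O_X` and their compatibilities. -/
structure SheafData where
  coh : Scheme.{u_1} → Type u
  cat : ∀ X : Scheme, Category.{v} (coh X)
  ab : ∀ X : Scheme, Abelian (coh X)
  pull : ∀ {X Y : Scheme}, (X ⟶ Y) → (coh Y ⥤ coh X)
  pull_id : ∀ X : Scheme, pull (𝟙 X) = 𝟭 (coh X)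
  pull_comp : ∀ {X Y Z : Scheme} (f : X ⟶ Y) (g : Y ⟶ Z), pull (f ≫ g) = pull g ⋙ pull f
  pull_rightExact : ∀ {X Y : Scheme} (f : X ⟶ Y), PreservesFiniteColimits (pull f)
  pull_additive : ∀ {X Y : Scheme} (f : X ⟶ Y), (pull f).Additive
  O : ∀ X : Scheme, coh X
  OIso : ∀ {X Y : Scheme} (f : X ⟶ Y), (pull f).obj (O Y) ≅ O X
  OIso_id : ∀ X : Scheme, (OIso (𝟙 X)).hom = eqToHom (by rw [pull_id]; rfl)
  OIso_comp : ∀ {X Y Z : Scheme} (f : X ⟶ Y) (g : Y ⟶ Z),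
    (OIso (f ≫ g)).hom =
      eqToHom (by rw [pull_comp]; rfl) ≫ (pull f).map (OIso g).hom ≫ (OIso f).hom

attribute [instance] SheafData.cat SheafData.ab

/-! ### Configuration schemes -/

/-- A configuration scheme `X/S`: a contravariant functor from a poset `S` to schemes of
finite type over `ℂ`, all of whose transition morphisms are closed immersions. -/
structure ConfigScheme (S : Type) [PartialOrder S] where
  X : S → Scheme
  toSpec : ∀ α : S, X α ⟶ Spec (CommRingCat.of ℂ)
  finiteType : ∀ α : S, LocallyOfFiniteType (toSpec α)
  f : ∀ {α β : S}, β ≤ α → (X β ⟶ X α)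
  f_refl : ∀ α : S, f (le_refl α) = 𝟙 (X α)
  f_trans : ∀ {α β γ : S} (h₁ : β ≤ α) (h₂ : γ ≤ β), f (h₂.trans h₁) = f h₂ ≫ f h₁
  f_over : ∀ {α β : S} (h : β ≤ α), f h ≫ toSpec α = toSpec β
  f_closed : ∀ {α β : S} (h : β ≤ α), IsClosedImmersion (f h)

/-- A configuration scheme is smooth if all the schemes `X(α)` are smooth over `ℂ`. -/
def ConfigScheme.Smooth {S : Type} [PartialOrder S] (CS : ConfigScheme S) : Prop :=
  ∀ α : S, AlgebraicGeometry.IsSmooth (CS.toSpec α)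

/-- The diagram of categories of coherent sheaves attached to a configuration scheme:
`C(α) = coh(X(α))` with transition functors the inverse images `f_{βα}^*`. -/
def ConfigScheme.diagram {S : Type} [PartialOrder S] (CS : ConfigScheme S)
    (SD : SheafData.{v, u}) : PosetDiagram S where
  C α := SD.coh (CS.X α)
  cat α := SD.cat _
  φ h := SD.pull (CS.f h)
  φ_refl α := by rw [CS.f_refl, SD.pull_id]
  φ_trans h₁ h₂ := by rw [CS.f_trans h₁ h₂, SD.pull_comp]

/-- The category `coh(X/S)` of coherent sheaves on a configuration scheme. -/
abbrev cohConf {S : Type} [PartialOrder S] (CS : ConfigScheme S) (SD : SheafData.{v, u}) :=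
  ConfObj (CS.diagram SD)

lemma SheafData.OIso_congr (SD : SheafData.{v, u}) {X Y : Scheme} {f g : X ⟶ Y} (h : f = g) :
    (SD.OIso f).hom = eqToHom (by rw [h]) ≫ (SD.OIso g).hom := by
  subst h; simp

/-- The structure sheaf `O_{X/S}` of a configuration scheme. -/
def confStructureSheaf {S : Type} [PartialOrder S] (CS : ConfigScheme S)
    (SD : SheafData.{v, u}) : cohConf CS SD where
  F α := SD.O (CS.X α)
  σ h := (SD.OIso (CS.f h)).hom
  σ_refl α := by
    have key : ∀ p, (SD.OIso (CS.f (le_refl α))).hom = eqToHom p := by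
      intro p
      rw [SD.OIso_congr (CS.f_refl α), SD.OIso_id]
      simp
    exact key _
  σ_trans {α β γ} h₁ h₂ := by
    have key : ∀ p, (SD.OIso (CS.f (h₂.trans h₁))).hom =
        eqToHom p ≫ (SD.pull (CS.f h₂)).map (SD.OIso (CS.f h₁)).hom ≫ (SD.OIso (CS.f h₂)).hom := by
      intro p
      rw [SD.OIso_congr (CS.f_trans h₁ h₂), SD.OIso_comp]
      simp
    exact key _

/-- The localization functor `coh(X₀) ⥤ coh(X/S)` attached to a compatible family of
(closed immersion) morphisms `t_α : X(α) ⟶ X₀`; it sends `F` to the collection of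
inverse images `(t_α^* F)_α`. -/
def locF {S : Type} [PartialOrder S] (CS : ConfigScheme S) (SD : SheafData.{v, u})
    (X₀ : Scheme) (t : ∀ α : S, CS.X α ⟶ X₀)
    (ht : ∀ {α β : S} (h : β ≤ α), CS.f h ≫ t α = t β) :
    SD.coh X₀ ⥤ cohConf CS SD where
  obj F :=
    { F := fun α => (SD.pull (t α)).obj F
      σ := fun {α β} h => eqToHom (by
        show ((SD.pull (t α)) ⋙ (SD.pull (CS.f h))).obj F = _
        rw [← SD.pull_comp, ht h])
      σ_refl := fun α => rfl
      σ_trans := fun {α β γ} h₁ h₂ => by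
        have key : ∀ (p : (SD.pull (CS.f (h₂.trans h₁))).obj ((SD.pull (t α)).obj F) =
              (SD.pull (t γ)).obj F)
            (q : (SD.pull (CS.f (h₂.trans h₁))).obj ((SD.pull (t α)).obj F) =
              (SD.pull (CS.f h₂)).obj ((SD.pull (CS.f h₁)).obj ((SD.pull (t α)).obj F)))
            (r : (SD.pull (CS.f h₁)).obj ((SD.pull (t α)).obj F) = (SD.pull (t β)).obj F)
            (s : (SD.pull (CS.f h₂)).obj ((SD.pull (t β)).obj F) = (SD.pull (t γ)).obj F),
            eqToHom p = eqToHom q ≫ (SD.pull (CS.f h₂)).map (eqToHom r) ≫ eqToHom s := by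
          intro p q r s
          simp [eqToHom_map]
        exact key _ _ _ _ }
  map u :=
    { f := fun α => (SD.pull (t α)).map u
      comm := fun {α β} h => by
        have hF : SD.pull (t α) ⋙ SD.pull (CS.f h) = SD.pull (t β) := by
          rw [← SD.pull_comp, ht h]
        have key : ∀ p q, (SD.pull (t α) ⋙ SD.pull (CS.f h)).map u ≫ eqToHom p =
            eqToHom q ≫ (SD.pull (t β)).map u := by
          intro p q
          rw [Functor.congr_hom hF u]
          simp
        exact key (Functor.congr_obj hF _) (Functor.congr_obj hF _) }
  map_id F := by apply ConfHom.ext; funext α; exact (SD.pull (t α)).map_id F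
  map_comp u v := by apply ConfHom.ext; funext α; exact (SD.pull (t α)).map_comp u v

attribute [local instance] MvPolynomial.gradedAlgebra

/-- Projective space `ℙ^n` over `ℂ`, as `Proj` of a graded polynomial ring. -/
noncomputable def ProjSpaceC (n : ℕ) : Scheme :=
  AlgebraicGeometry.Proj (MvPolynomial.homogeneousSubmodule (Fin (n + 1)) ℂ)

/-- A scheme is a projective variety over `ℂ` if it is integral and admits a closed
immersion into some projective space over `ℂ`. -/
def IsProjectiveVariety (X : Scheme) : Prop :=
  IsIntegral X ∧ ∃ (n : ℕ) (i : X ⟶ ProjSpaceC n), IsClosedImmersion i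
section DerivedPreamble

variable (A : Type u) [Category.{v} A] [Abelian A] [HasDerivedCategory.{w} A]

/-- An object of the derived category is (cohomologically) bounded. -/
def BoundedObj (X : DerivedCategory A) : Prop :=
  ∃ a b : ℤ, ∀ i : ℤ, (i < a ∨ b < i) → IsZero ((DerivedCategory.homologyFunctor A i).obj X)

/-- The bounded derived category `D^b(A)`, realized as the full subcategory of
cohomologically bounded objects of the derived category. -/
abbrev Db := ObjectProperty.FullSubcategory (BoundedObj A)

variable {A}

lemma boundedObj_single (X : A) :
    BoundedObj A ((DerivedCategory.singleFunctor A 0).obj X) := by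
  refine ⟨0, 0, fun i hi => ?_⟩
  have hne : i ≠ 0 := by rcases hi with h | h <;> omega
  have e : (DerivedCategory.homologyFunctor A i).obj
      ((DerivedCategory.singleFunctor A 0).obj X) ≅
      ((HomologicalComplex.single A (ComplexShape.up ℤ) 0).obj X).homology i :=
    (DerivedCategory.homologyFunctor A i).mapIso
      ((DerivedCategory.quotientCompQhIso A).app
        ((HomologicalComplex.single A (ComplexShape.up ℤ) 0).obj X)) ≪≫
      (DerivedCategory.homologyFunctorFactors A i).app _
  exact (HomologicalComplex.isZero_single_obj_homology _ 0 X i hne).of_iso e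

variable (A)

/-- The canonical functor `A ⥤ D^b(A)` sending `X` to the complex concentrated in degree 0. -/
noncomputable def toDb : A ⥤ Db A :=
  ObjectProperty.lift _ (DerivedCategory.singleFunctor A 0) boundedObj_single

end DerivedPreamble

namespace CategoryTheory.Adjunction

section

universe v₁ v₂ u₁ u₂

variable {A : Type u₁} {B : Type u₂} [Category.{v₁} A] [Category.{v₂} B] {L : A ⥤ B} {R : B ⥤ A}

/-- A functor has a left adjoint with invertible unit as soon as every `X` is isomorphic to some
`R.obj Y` such that `R` is bijective on morphisms out of `Y`. -/
theorem exists_leftAdjoint_of_bijective (R : B ⥤ A) (P : B → Prop)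
    (h : ∀ X : A, ∃ (Y : B) (_ : X ≅ R.obj Y), P Y ∧
      ∀ Z, Function.Bijective (fun u : Y ⟶ Z => R.map u)) :
    ∃ (L : A ⥤ B) (adj : L ⊣ R), IsIso adj.unit ∧ ∀ X, P (L.obj X) := by
  choose Y e hP hb using h
  let E : ∀ X Z, (Y X ⟶ Z) ≃ (X ⟶ R.obj Z) := fun X Z =>
    (Equiv.ofBijective _ (hb X Z)).trans (Iso.homFromEquiv (e X)).symm
  have hE : ∀ X Z Z' (g : Z ⟶ Z') (k : Y X ⟶ Z), E X Z' (k ≫ g) = E X Z k ≫ R.map g := by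
    intro X Z Z' g k
    simp [E, Iso.homFromEquiv]
  refine ⟨_, adjunctionOfEquivLeft E hE, ?_, hP⟩
  have : ∀ X, IsIso ((adjunctionOfEquivLeft E hE).unit.app X) := by
    intro X
    have : (adjunctionOfEquivLeft E hE).unit.app X = (e X).hom := by
      rw [adjunctionOfEquivLeft_unit_app]
      simp only [E, Equiv.trans_apply, Equiv.ofBijective_apply, Functor.map_id]
      exact Category.comp_id _
    rw [this]
    infer_instance
  exact NatIso.isIso_of_isIso_app _

/-- A functor has a right adjoint with invertible counit as soon as every `Y` is isomorphic to some
`L.obj X` such that `L` is bijective on morphisms into `X`. -/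
theorem exists_rightAdjoint_of_bijective (L : A ⥤ B) (P : A → Prop)
    (h : ∀ Y : B, ∃ (X : A) (_ : L.obj X ≅ Y), P X ∧
      ∀ Z, Function.Bijective (fun u : Z ⟶ X => L.map u)) :
    ∃ (R : B ⥤ A) (adj : L ⊣ R), IsIso adj.counit ∧ ∀ Y, P (R.obj Y) := by
  choose X e hP hb using h
  let E : ∀ Z Y, (L.obj Z ⟶ Y) ≃ (Z ⟶ X Y) := fun Z Y =>
    (Iso.homToEquiv (e Y)).symm.trans (Equiv.ofBijective _ (hb Y Z)).symm
  have hE : ∀ Z' Z Y (f : Z' ⟶ Z) (g : L.obj Z ⟶ Y), E Z' Y (L.map f ≫ g) = f ≫ E Z Y g := by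
    intro Z' Z Y f g
    apply (hb Y Z').1
    have h1 : ∀ Z (g : L.obj Z ⟶ Y), L.map (E Z Y g) = g ≫ (e Y).inv := fun Z g =>
      (Equiv.ofBijective _ (hb Y Z)).apply_symm_apply ((Iso.homToEquiv (e Y)).symm g)
    simp [h1]
  refine ⟨_, adjunctionOfEquivRight E hE, ?_, hP⟩
  have : ∀ Y, IsIso ((adjunctionOfEquivRight E hE).counit.app Y) := by
    intro Y
    have : (adjunctionOfEquivRight E hE).counit.app Y = (e Y).hom := by
      simp [E, Iso.homToEquiv]
    rw [this]
    infer_instance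
  exact NatIso.isIso_of_isIso_app _

/-- Adjoint functors between abelian categories are exact if the left adjoint preserves
monomorphisms and the right adjoint preserves epimorphisms. -/
theorem exact_of_preserves [Abelian A] [Abelian B] (adj : L ⊣ R)
    [L.PreservesMonomorphisms] [R.PreservesEpimorphisms] :
    (L.Additive ∧ PreservesFiniteLimits L ∧ PreservesFiniteColimits L) ∧
      R.Additive ∧ PreservesFiniteLimits R ∧ PreservesFiniteColimits R := by
  have hL : PreservesFiniteColimits L :=
    have := adj.leftAdjoint_preservesColimits; inferInstance
  have hR : PreservesFiniteLimits R :=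
    have := adj.rightAdjoint_preservesLimits; inferInstance
  have aR : R.Additive := Functor.additive_of_preserves_binary_products R
  have aL : L.Additive := adj.left_adjoint_additive
  refine ⟨⟨aL, ?_, hL⟩, aR, hR, ?_⟩
  · rw [Functor.preservesFiniteLimits_iff_forall_exact_map_and_mono]
    intro T hT
    have := hT.mono_f
    have h := (Functor.preservesFiniteColimits_iff_forall_exact_map_and_epi L).1 hL T hT
    exact ⟨h.1, inferInstance⟩
  · rw [Functor.preservesFiniteColimits_iff_forall_exact_map_and_epi]
    intro T hT
    have := hT.epi_g
    have h := (Functor.preservesFiniteLimits_iff_forall_exact_map_and_mono R).1 hR T hT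
    exact ⟨h.1, inferInstance⟩

end

section

universe v₁ v₂ u₁ u₂

variable {A : Type u₁} {B : Type u₂} [Category.{v₁} A] [Category.{v₂} B]
  [Preadditive A] [Preadditive B] {L : A ⥤ B} {R : B ⥤ A}

/-- An adjunction between additive functors extends to complexes, degreewise. -/
@[simps]
def mapHomologicalComplex {ι : Type*} (adj : L ⊣ R) [L.Additive] [R.Additive]
    (c : ComplexShape ι) : L.mapHomologicalComplex c ⊣ R.mapHomologicalComplex c where
  unit.app K :=
    { f i := adj.unit.app (K.X i)
      comm' i j _ := (adj.unit.naturality (K.d i j)).symm }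
  unit.naturality _ _ f := by ext i; exact adj.unit.naturality (f.f i)
  counit.app K :=
    { f i := adj.counit.app (K.X i)
      comm' i j _ := (adj.counit.naturality (K.d i j)).symm }
  counit.naturality _ _ f := by ext i; exact adj.counit.naturality (f.f i)
  left_triangle_components K := by ext i; exact adj.left_triangle_components (K.X i)
  right_triangle_components K := by ext i; exact adj.right_triangle_components (K.X i)

end

section

universe w₁ w₂ v₁ v₂ u₁ u₂

variable {A : Type u₁} {B : Type u₂} [Category.{v₁} A] [Category.{v₂} B] [Abelian A] [Abelian B]
  [HasDerivedCategory.{w₁} A] [HasDerivedCategory.{w₂} B] {L : A ⥤ B} {R : B ⥤ A}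
  [L.Additive] [PreservesFiniteLimits L] [PreservesFiniteColimits L]
  [R.Additive] [PreservesFiniteLimits R] [PreservesFiniteColimits R]

/-- An adjunction between exact functors extends to the derived categories. -/
noncomputable def mapDerivedCategory (adj : L ⊣ R) :
    L.mapDerivedCategory ⊣ R.mapDerivedCategory :=
  letI : CatCommSq (L.mapHomologicalComplex (ComplexShape.up ℤ)) DerivedCategory.Q
    DerivedCategory.Q L.mapDerivedCategory := ⟨L.mapDerivedCategoryFactors.symm⟩
  letI : CatCommSq (R.mapHomologicalComplex (ComplexShape.up ℤ)) DerivedCategory.Q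
    DerivedCategory.Q R.mapDerivedCategory := ⟨R.mapDerivedCategoryFactors.symm⟩
  (adj.mapHomologicalComplex (ComplexShape.up ℤ)).localization
    DerivedCategory.Q (HomologicalComplex.quasiIso A (ComplexShape.up ℤ))
    DerivedCategory.Q (HomologicalComplex.quasiIso B (ComplexShape.up ℤ)) _ _

instance (adj : L ⊣ R) [IsIso adj.unit] : IsIso adj.mapDerivedCategory.unit := by
  have key : ∀ X, IsIso (adj.mapDerivedCategory.unit.app (DerivedCategory.Q.obj X)) := by
    intro X
    have : IsIso ((adj.mapHomologicalComplex (ComplexShape.up ℤ)).unit.app X) := by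
      have : ∀ i, IsIso (((adj.mapHomologicalComplex (ComplexShape.up ℤ)).unit.app X).f i) :=
        fun i => inferInstanceAs (IsIso (adj.unit.app (X.X i)))
      apply HomologicalComplex.Hom.isIso_of_components
    rw [mapDerivedCategory, localization_unit_app]
    infer_instance
  have : ∀ X, IsIso (adj.mapDerivedCategory.unit.app X) := by
    intro X
    have e := DerivedCategory.Q.objObjPreimageIso X
    rw [← NatTrans.isIso_app_iff_of_iso _ e]
    apply key
  exact NatIso.isIso_of_isIso_app _

instance (adj : L ⊣ R) [IsIso adj.counit] : IsIso adj.mapDerivedCategory.counit := by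
  have key : ∀ X, IsIso (adj.mapDerivedCategory.counit.app (DerivedCategory.Q.obj X)) := by
    intro X
    have : IsIso ((adj.mapHomologicalComplex (ComplexShape.up ℤ)).counit.app X) := by
      have : ∀ i, IsIso (((adj.mapHomologicalComplex (ComplexShape.up ℤ)).counit.app X).f i) :=
        fun i => inferInstanceAs (IsIso (adj.counit.app (X.X i)))
      apply HomologicalComplex.Hom.isIso_of_components
    rw [mapDerivedCategory, localization_counit_app]
    infer_instance
  have : ∀ X, IsIso (adj.mapDerivedCategory.counit.app X) := by
    intro X
    have e := DerivedCategory.Q.objObjPreimageIso X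
    rw [← NatTrans.isIso_app_iff_of_iso _ e]
    apply key
  exact NatIso.isIso_of_isIso_app _

end

end CategoryTheory.Adjunction

namespace ConfObj

variable {D : PosetDiagram.{v, u} S}

lemma hom_ext {F G : ConfObj D} {a b : F ⟶ G} (h : ∀ α, a.f α = b.f α) : a = b :=
  ConfHom.ext (funext h)

lemma mono_of_mono_f {F G : ConfObj D} (a : F ⟶ G) (h : ∀ α, Mono (a.f α)) : Mono a where
  right_cancellation x y hxy := hom_ext fun α => by
    rw [← cancel_mono (a.f α)]
    exact congrArg (fun t => ConfHom.f t α) hxy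

lemma epi_of_epi_f {F G : ConfObj D} (a : F ⟶ G) (h : ∀ α, Epi (a.f α)) : Epi a where
  left_cancellation x y hxy := hom_ext fun α => by
    rw [← cancel_epi (a.f α)]
    exact congrArg (fun t => ConfHom.f t α) hxy

end ConfObj

namespace PosetDiagram

variable (D : PosetDiagram.{v, u} S)

lemma φ_refl_map {α : S} {X Y : D.C α} (f : X ⟶ Y) :
    (D.φ (le_refl α)).map f =
      eqToHom (by rw [D.φ_refl]; rfl) ≫ f ≫ eqToHom (by rw [D.φ_refl]; rfl) :=
  Functor.congr_hom (D.φ_refl α) f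

lemma φ_trans_map {α β γ : S} (h₁ : β ≤ α) (h₂ : γ ≤ β) {X Y : D.C α} (f : X ⟶ Y) :
    (D.φ (h₂.trans h₁)).map f =
      eqToHom (by rw [D.φ_trans h₁ h₂]; rfl) ≫ (D.φ h₂).map ((D.φ h₁).map f) ≫
        eqToHom (by rw [D.φ_trans h₁ h₂]; rfl) :=
  Functor.congr_hom (D.φ_trans h₁ h₂) f

end PosetDiagram

namespace ConfObj

variable {D : PosetDiagram.{v, u} S} [∀ α, Abelian (D.C α)]
  [∀ {α β : S} (h : β ≤ α), (D.φ h).Additive]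

/-- The pointwise zero morphism. -/
def zeroHom (F G : ConfObj D) : F ⟶ G where
  f _ := 0
  comm _ := by simp

/-- The pointwise kernel. -/
noncomputable def kernelObj {F G : ConfObj D} (a : F ⟶ G) : ConfObj D where
  F α := kernel (a.f α)
  σ {α β} h := kernel.lift _ ((D.φ h).map (kernel.ι (a.f α)) ≫ F.σ h) (by
    rw [Category.assoc, ← a.comm h, ← Functor.map_comp_assoc]
    simp)
  σ_refl α := by
    rw [← cancel_mono (kernel.ι (a.f α)), kernel.lift_ι, D.φ_refl_map, F.σ_refl]
    simp
  σ_trans {α β γ} h₁ h₂ := by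
    rw [← cancel_mono (kernel.ι (a.f γ))]
    simp only [Category.assoc, kernel.lift_ι]
    rw [← Functor.map_comp_assoc, kernel.lift_ι, D.φ_trans_map h₁ h₂, F.σ_trans h₁ h₂]
    simp

/-- The inclusion of the pointwise kernel. -/
noncomputable def kernelObjι {F G : ConfObj D} (a : F ⟶ G) : kernelObj a ⟶ F where
  f α := kernel.ι (a.f α)
  comm _ := (kernel.lift_ι _ _ _).symm

lemma mono_f {F G : ConfObj D} (a : F ⟶ G) [Mono a] (α : S) : Mono (a.f α) := by
  have h : kernelObjι a ≫ a = zeroHom _ _ ≫ a :=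
    hom_ext fun β => (kernel.condition (a.f β)).trans zero_comp.symm
  rw [cancel_mono] at h
  exact Preadditive.mono_of_kernel_zero (congrArg (fun t => ConfHom.f t α) h)

section

variable [∀ {α β : S} (h : β ≤ α), PreservesFiniteColimits (D.φ h)]

/-- The pointwise cokernel, which exists as the transition functors are right exact. -/
noncomputable def cokernelObj {F G : ConfObj D} (a : F ⟶ G) : ConfObj D where
  F α := cokernel (a.f α)
  σ {α β} h := (PreservesCokernel.iso (D.φ h) (a.f α)).hom ≫
    cokernel.desc _ (G.σ h ≫ cokernel.π (a.f β)) (by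
      rw [← Category.assoc, a.comm h, Category.assoc, cokernel.condition, comp_zero])
  σ_refl α := by
    rw [← cancel_epi ((D.φ (le_refl α)).map (cokernel.π (a.f α)))]
    rw [PreservesCokernel.π_iso_hom_assoc, cokernel.π_desc, D.φ_refl_map, G.σ_refl]
    simp
  σ_trans {α β γ} h₁ h₂ := by
    rw [← cancel_epi ((D.φ (h₂.trans h₁)).map (cokernel.π (a.f α)))]
    rw [PreservesCokernel.π_iso_hom_assoc, cokernel.π_desc, D.φ_trans_map h₁ h₂,
      G.σ_trans h₁ h₂]
    simp only [Category.assoc, eqToHom_trans_assoc, eqToHom_refl, Category.id_comp]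
    rw [← Functor.map_comp_assoc, PreservesCokernel.π_iso_hom_assoc, cokernel.π_desc,
      Functor.map_comp_assoc, PreservesCokernel.π_iso_hom_assoc, cokernel.π_desc]

/-- The projection onto the pointwise cokernel. -/
noncomputable def cokernelObjπ {F G : ConfObj D} (a : F ⟶ G) : G ⟶ cokernelObj a where
  f α := cokernel.π (a.f α)
  comm {α _} h :=
    (PreservesCokernel.π_iso_hom_assoc (D.φ h) (a.f α) _).trans (cokernel.π_desc _ _ _)

lemma epi_f {F G : ConfObj D} (a : F ⟶ G) [Epi a] (α : S) : Epi (a.f α) := by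
  have h : a ≫ cokernelObjπ a = a ≫ zeroHom _ _ :=
    hom_ext fun β => (cokernel.condition (a.f β)).trans comp_zero.symm
  rw [cancel_epi] at h
  exact Preadditive.epi_of_cokernel_zero (congrArg (fun t => ConfHom.f t α) h)

end

open scoped ZeroObject

open Classical in
/-- The object with prescribed components and vanishing transition morphisms off the diagonal. -/
noncomputable def discrete (Y : ∀ α, D.C α) : ConfObj D where
  F := Y
  σ {α β} h := if hαβ : α = β then eqToHom (by subst hαβ; rw [D.φ_refl]; rfl) else 0
  σ_refl α := by simp
  σ_trans {α β γ} h₁ h₂ := by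
    by_cases hαβ : α = β
    · subst hαβ
      by_cases hαγ : α = γ
      · subst hαγ
        simp [eqToHom_map]
      · simp [hαγ]
    · have hαγ : α ≠ γ := by
        rintro rfl
        exact hαβ (le_antisymm h₂ h₁)
      simp [hαβ, hαγ]

open Classical in
omit [∀ {α β : S} (h : β ≤ α), (D.φ h).Additive] in
/-- An object supported at a maximal element `α` is determined by its component there. -/
lemma evalF_map_bijective {α : S} (hα : ∀ β, α ≤ β → β = α) (G X : ConfObj D)
    (hX : ∀ β, β ≠ α → IsZero (X.F β)) :
    Function.Bijective (fun u : G ⟶ X => (evalF D α).map u) := by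
  constructor
  · intro a b hab
    refine hom_ext fun β => ?_
    by_cases h : β = α
    · subst h
      exact hab
    · exact (hX β h).eq_of_tgt _ _
  · intro g
    change G.F α ⟶ X.F α at g
    refine ⟨⟨fun β => if h : α = β then h ▸ g else 0, ?_⟩, ?_⟩
    · intro γ β h
      by_cases hβ : α = β
      · subst hβ
        obtain rfl := hα γ h
        rw [dif_pos rfl, X.σ_refl, G.σ_refl]
        change (D.φ (le_refl γ)).map g ≫ _ = _ ≫ g
        rw [D.φ_refl_map]
        simp
      · exact (hX β (Ne.symm hβ)).eq_of_tgt _ _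
    · exact dif_pos rfl

open Classical in
/-- Evaluation at a maximal element has a fully faithful right adjoint, extension by zero. -/
theorem exists_rightAdjoint_evalF {α : S} (hα : ∀ β, α ≤ β → β = α) :
    ∃ (i : D.C α ⥤ ConfObj D) (adj : evalF D α ⊣ i), IsIso adj.counit ∧
      ∀ Y, ∀ β, β ≠ α → IsZero ((i.obj Y).F β) := by
  refine Adjunction.exists_rightAdjoint_of_bijective (evalF D α)
    (fun X => ∀ β, β ≠ α → IsZero (X.F β)) fun Y => ?_
  have hZ : ∀ β, β ≠ α → IsZero (Function.update (fun β => (0 : D.C β)) α Y β) := by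
    intro β hβ
    rw [Function.update_of_ne hβ]
    exact isZero_zero _
  exact ⟨discrete (Function.update (fun β => (0 : D.C β)) α Y),
    eqToIso (show Function.update (fun β => (0 : D.C β)) α Y α = Y from
      Function.update_self α Y _), hZ, fun Z => evalF_map_bijective hα Z _ hZ⟩

open Classical in
/-- An object supported in a lower set is determined by its restriction. -/
lemma resF_map_bijective {T : Set S} (hT : IsLowerSet T) (X G : ConfObj D)
    (hX : SuppIn X T) : Function.Bijective (fun u : X ⟶ G => (resF D T).map u) := by
  constructor
  · intro a b hab
    refine hom_ext fun β => ?_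
    by_cases h : β ∈ T
    · exact congrArg (fun t => ConfHom.f t ⟨β, h⟩) hab
    · exact (hX β h).eq_of_src _ _
  · intro g
    refine ⟨⟨fun β => if h : β ∈ T then g.f ⟨β, h⟩ else 0, ?_⟩, ?_⟩
    · intro α β h
      by_cases hα : α ∈ T
      · simpa [hα, hT h hα] using! g.comm (α := ⟨α, hα⟩) (β := ⟨β, hT h hα⟩) h
      · exact ((D.φ h).map_isZero (hX α hα)).eq_of_src _ _
    · refine hom_ext fun t => ?_
      simp [resF]

section

variable {T : Set S} (G : ConfObj (D.restrict T))

/-- The components of an object over a subset, seen in the ambient diagram. -/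
def compF {β : S} (hβ : β ∈ T) : D.C β := G.F ⟨β, hβ⟩

/-- The transition morphisms of an object over a subset, seen in the ambient diagram. -/
def compσ {α β : S} (h : β ≤ α) (hα : α ∈ T) (hβ : β ∈ T) :
    (D.φ h).obj (G.compF hα) ⟶ G.compF hβ :=
  G.σ (α := ⟨α, hα⟩) (β := ⟨β, hβ⟩) h

omit [∀ α, Abelian (D.C α)] [∀ {α β : S} (h : β ≤ α), (D.φ h).Additive] in
lemma compσ_refl {α : S} (hα : α ∈ T) :
    G.compσ (le_refl α) hα hα = eqToHom (by rw [D.φ_refl]; rfl) :=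
  G.σ_refl ⟨α, hα⟩

omit [∀ α, Abelian (D.C α)] [∀ {α β : S} (h : β ≤ α), (D.φ h).Additive] in
lemma compσ_trans {α β γ : S} (h₁ : β ≤ α) (h₂ : γ ≤ β) (hα : α ∈ T) (hβ : β ∈ T) (hγ : γ ∈ T) :
    G.compσ (h₂.trans h₁) hα hγ = eqToHom (by rw [D.φ_trans h₁ h₂]; rfl) ≫
      (D.φ h₂).map (G.compσ h₁ hα hβ) ≫ G.compσ h₂ hβ hγ :=
  G.σ_trans (α := ⟨α, hα⟩) (β := ⟨β, hβ⟩) (γ := ⟨γ, hγ⟩) h₁ h₂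

end

open Classical in
/-- Restriction to a lower set has a fully faithful left adjoint, extension by zero. -/
theorem exists_leftAdjoint_resF {T : Set S} (hT : IsLowerSet T) :
    ∃ (j : ConfObj (D.restrict T) ⥤ ConfObj D) (adj : j ⊣ resF D T), IsIso adj.unit ∧
      ∀ G, SuppIn (j.obj G) T := by
  refine Adjunction.exists_leftAdjoint_of_bijective (resF D T) (fun X => SuppIn X T) fun G => ?_
  have hY : ∀ β, ∃ (Y : D.C β) (_ : ∀ h : β ∈ T, Y ≅ G.compF h), β ∉ T → IsZero Y := by
    intro β
    by_cases h : β ∈ T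
    · exact ⟨G.compF h, fun _ => Iso.refl _, fun h' => (h' h).elim⟩
    · exact ⟨0, fun h' => (h h').elim, fun _ => isZero_zero _⟩
  choose Y e hZ using hY
  let X : ConfObj D :=
    { F := Y
      σ := fun {α β} h => if hα : α ∈ T then
        (D.φ h).map (e α hα).hom ≫ G.compσ h hα (hT h hα) ≫ (e β (hT h hα)).inv else 0
      σ_refl := fun α => by
        by_cases hα : α ∈ T
        · rw [dif_pos hα, G.compσ_refl, D.φ_refl_map]
          simp
        · exact ((D.φ _).map_isZero (hZ α hα)).eq_of_src _ _
      σ_trans := fun {α β γ} h₁ h₂ => by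
        by_cases hα : α ∈ T
        · rw [dif_pos hα, dif_pos hα, dif_pos (hT h₁ hα),
            G.compσ_trans h₁ h₂ hα (hT h₁ hα), D.φ_trans_map h₁ h₂]
          simp
        · exact ((D.φ _).map_isZero (hZ α hα)).eq_of_src _ _ }
  have hX : ∀ {α β : S} (h : β ≤ α) (hα : α ∈ T) (hβ : β ∈ T), X.σ h =
      (D.φ h).map (e α hα).hom ≫ G.compσ h hα hβ ≫ (e β hβ).inv :=
    fun h hα hβ => dif_pos hα
  refine ⟨X, ⟨⟨fun t => (e t.1 t.2).inv, ?_⟩, ⟨fun t => (e t.1 t.2).hom, ?_⟩, ?_, ?_⟩, hZ,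
    fun H => resF_map_bijective hT X H hZ⟩
  · intro t s h
    change (D.φ h).map (e t.1 t.2).inv ≫ X.σ h = G.compσ h t.2 s.2 ≫ (e s.1 s.2).inv
    rw [hX h t.2 s.2, ← Functor.map_comp_assoc, Iso.inv_hom_id,
      CategoryTheory.Functor.map_id, Category.id_comp]
  · intro t s h
    change (D.φ h).map (e t.1 t.2).hom ≫ G.compσ h t.2 s.2 = X.σ h ≫ (e s.1 s.2).hom
    rw [hX h t.2 s.2]
    simp
  · exact hom_ext fun t => (e t.1 t.2).inv_hom_id
  · exact hom_ext fun t => (e t.1 t.2).hom_inv_id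

end ConfObj

section

universe w₁ w₂ w₃ v₁ v₂ v₃ u₁ u₂ u₃

variable {A : Type u₁} {B : Type u₂} {C : Type u₃} [Category.{v₁} A] [Category.{v₂} B]
  [Category.{v₃} C] [Abelian A] [Abelian B] [Abelian C]
  [HasDerivedCategory.{w₁} A] [HasDerivedCategory.{w₂} B] [HasDerivedCategory.{w₃} C]

lemma BoundedObj.mapDerivedCategory (F : A ⥤ B) [F.Additive] [PreservesFiniteLimits F]
    [PreservesFiniteColimits F] {X : DerivedCategory A} (hX : BoundedObj A X) :
    BoundedObj B (F.mapDerivedCategory.obj X) := by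
  obtain ⟨a, b, h⟩ := hX
  refine ⟨a, b, fun n hn => ?_⟩
  let K := DerivedCategory.Q.objPreimage X
  let e : DerivedCategory.Q.obj K ≅ X := DerivedCategory.Q.objObjPreimageIso X
  have hK : IsZero (K.homology n) := (h n hn).of_iso
    (((DerivedCategory.homologyFunctorFactors A n).app K).symm ≪≫
      (DerivedCategory.homologyFunctor A n).mapIso e)
  have eF : ((F.mapHomologicalComplex (ComplexShape.up ℤ)).obj K).homology n ≅
      F.obj (K.homology n) := (K.sc n).mapHomologyIso F
  exact ((F.map_isZero hK).of_iso eF).of_iso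
    ((DerivedCategory.homologyFunctor B n).mapIso
      (F.mapDerivedCategory.mapIso e.symm ≪≫ F.mapDerivedCategoryFactors.app K) ≪≫
      (DerivedCategory.homologyFunctorFactors B n).app _)

/-- The functor between bounded derived categories induced by an exact functor. -/
noncomputable def mapDb (F : A ⥤ B) [F.Additive] [PreservesFiniteLimits F]
    [PreservesFiniteColimits F] : Db A ⥤ Db B :=
  ObjectProperty.lift _ (ObjectProperty.ι _ ⋙ F.mapDerivedCategory)
    fun X => X.property.mapDerivedCategory F

/-- `mapDb F` extends `F`. -/
noncomputable def toDbCompMapDbIso (F : A ⥤ B) [F.Additive] [PreservesFiniteLimits F]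
    [PreservesFiniteColimits F] : toDb A ⋙ mapDb F ≅ F ⋙ toDb B :=
  Functor.fullyFaithfulCancelRight (ObjectProperty.ι _)
    (show (toDb A ⋙ mapDb F) ⋙ ObjectProperty.ι _ ≅ (F ⋙ toDb B) ⋙ ObjectProperty.ι _ from
      F.mapDerivedCategorySingleFunctor 0)

lemma mapDb_full_faithful (F : A ⥤ B) [F.Additive] [PreservesFiniteLimits F]
    [PreservesFiniteColimits F] (hF : F.mapDerivedCategory.FullyFaithful) :
    (mapDb F).Full ∧ (mapDb F).Faithful := by
  have := hF.full
  have := hF.faithful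
  exact ⟨inferInstanceAs (ObjectProperty.lift _ _ _).Full,
    inferInstanceAs (ObjectProperty.lift _ _ _).Faithful⟩

/-- For `i` right adjoint and `j` left adjoint to exact functors, both exact and with invertible
counit and unit respectively, `i ⋙ j` induces a fully faithful functor on `D^b`. -/
theorem exists_Db_full_faithful {e : B ⥤ A} {i : A ⥤ B} {j : B ⥤ C} {r : C ⥤ B}
    (adj₁ : e ⊣ i) [IsIso adj₁.counit] (adj₂ : j ⊣ r) [IsIso adj₂.unit]
    [e.PreservesMonomorphisms] [i.PreservesEpimorphisms]
    [j.PreservesMonomorphisms] [r.PreservesEpimorphisms] :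
    ∃ E : Db A ⥤ Db C, Nonempty (toDb A ⋙ E ≅ (i ⋙ j) ⋙ toDb C) ∧ E.Full ∧ E.Faithful := by
  obtain ⟨⟨_, _, _⟩, _, _, _⟩ := adj₁.exact_of_preserves
  obtain ⟨⟨_, _, _⟩, _, _, _⟩ := adj₂.exact_of_preserves
  obtain ⟨_, _⟩ := mapDb_full_faithful i adj₁.mapDerivedCategory.fullyFaithfulROfIsIsoCounit
  obtain ⟨_, _⟩ := mapDb_full_faithful j adj₂.mapDerivedCategory.fullyFaithfulLOfIsIsoUnit
  exact ⟨mapDb i ⋙ mapDb j,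
    ⟨(Functor.associator _ _ _).symm ≪≫ Functor.isoWhiskerRight (toDbCompMapDbIso i) _ ≪≫
      Functor.associator _ _ _ ≪≫ Functor.isoWhiskerLeft i (toDbCompMapDbIso j) ≪≫
      (Functor.associator _ _ _).symm⟩, inferInstance, inferInstance⟩

end

namespace ConfObj

variable {D : PosetDiagram.{v, u} S} [∀ α, Abelian (D.C α)]
  [∀ {α β : S} (h : β ≤ α), (D.φ h).Additive]

instance (α : S) : (evalF D α).PreservesMonomorphisms where
  preserves a _ := mono_f a α

omit [∀ {α β : S} (h : β ≤ α), (D.φ h).Additive] in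
lemma preservesEpimorphisms_of_evalF_adjunction {α : S} {i : D.C α ⥤ ConfObj D}
    (adj : evalF D α ⊣ i) [IsIso adj.counit] (hi : ∀ Y, ∀ β, β ≠ α → IsZero ((i.obj Y).F β)) :
    i.PreservesEpimorphisms where
  preserves {X Y} a _ := epi_of_epi_f _ fun β => by
    by_cases hβ : β = α
    · subst hβ
      have h : (evalF D β).map (i.map a) =
          adj.counit.app X ≫ a ≫ inv (adj.counit.app Y) := by
        rw [← Category.assoc, IsIso.eq_comp_inv]
        exact adj.counit.naturality a
      have : Epi ((evalF D β).map (i.map a)) := by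
        rw [h]
        infer_instance
      exact this
    · exact ⟨fun _ _ _ => (hi Y β hβ).eq_of_src _ _⟩

lemma resF_preservesEpimorphisms [∀ {α β : S} (h : β ≤ α), PreservesFiniteColimits (D.φ h)]
    (T : Set S) : (resF D T).PreservesEpimorphisms where
  preserves a _ := epi_of_epi_f _ fun t => epi_f a t.1

omit [∀ α, Abelian (D.C α)] [∀ {α β : S} (h : β ≤ α), (D.φ h).Additive] in
lemma preservesMonomorphisms_of_resF_adjunction {T : Set S}
    {j : ConfObj (D.restrict T) ⥤ ConfObj D} (adj : j ⊣ resF D T) [IsIso adj.unit]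
    (hj : ∀ G, SuppIn (j.obj G) T)
    (hmono : ∀ {F G : ConfObj (D.restrict T)} (a : F ⟶ G) [Mono a] (t : T), Mono (a.f t)) :
    j.PreservesMonomorphisms where
  preserves {X Y} a _ := mono_of_mono_f _ fun β => by
    by_cases hβ : β ∈ T
    · have h : (resF D T).map (j.map a) =
          inv (adj.unit.app X) ≫ a ≫ adj.unit.app Y := by
        rw [IsIso.eq_inv_comp]
        exact (adj.unit.naturality a).symm
      have : Mono ((resF D T).map (j.map a)) := by
        rw [h]
        infer_instance
      exact hmono ((resF D T).map (j.map a)) ⟨β, hβ⟩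
    · exact ⟨fun _ _ _ => (hj X β hβ).eq_of_tgt _ _⟩

end ConfObj

namespace PosetDiagram

variable (D : PosetDiagram.{v, u} S)

noncomputable instance [h : ∀ α, Abelian (D.C α)] (T : Set S) (t : T) :
    Abelian ((D.restrict T).C t) := h t.1

instance [∀ α, Abelian (D.C α)] [h : ∀ {α β : S} (h : β ≤ α), (D.φ h).Additive] (T : Set S)
    {s t : T} (hst : t ≤ s) : ((D.restrict T).φ hst).Additive :=
  h (α := s.1) (β := t.1) hst

/-- Sheaves on a stratum embed fully faithfully on the level of bounded derived categories. -/
theorem exists_Db_stratum [∀ α, Abelian (D.C α)]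
    [∀ {α β : S} (h : β ≤ α), (D.φ h).Additive]
    [∀ {α β : S} (h : β ≤ α), PreservesFiniteColimits (D.φ h)] (α : S)
    [Abelian (ConfObj D)] [Abelian (ConfObj (D.restrict (Set.Iic α)))]
    [HasDerivedCategory.{w} (ConfObj D)]
    [HasDerivedCategory.{w} (ConfObj (D.restrict (Set.Iic α)))]
    [HasDerivedCategory.{w} (D.C α)] :
    ∃ (i₀ : D.C α ⥤ ConfObj (D.restrict (Set.Iic α)))
      (j₀ : ConfObj (D.restrict (Set.Iic α)) ⥤ ConfObj D)
      (E : Db (D.C α) ⥤ Db (ConfObj D)),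
      Nonempty (evalF (D.restrict (Set.Iic α)) ⟨α, Set.mem_Iic.mpr (le_refl α)⟩ ⊣ i₀) ∧
      Nonempty (j₀ ⊣ resF D (Set.Iic α)) ∧
      Nonempty (toDb (D.C α) ⋙ E ≅ (i₀ ⋙ j₀) ⋙ toDb (ConfObj D)) ∧
      E.Full ∧ E.Faithful := by
  obtain ⟨i, adj₁, _, hi⟩ := ConfObj.exists_rightAdjoint_evalF (D := D.restrict (Set.Iic α))
    (α := ⟨α, Set.mem_Iic.mpr (le_refl α)⟩) fun β hβ => le_antisymm β.2 hβ
  obtain ⟨j, adj₂, _, hj⟩ := ConfObj.exists_leftAdjoint_resF (D := D) (isLowerSet_Iic α)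
  have := ConfObj.preservesEpimorphisms_of_evalF_adjunction adj₁ hi
  have := ConfObj.preservesMonomorphisms_of_resF_adjunction adj₂ hj fun a _ t => ConfObj.mono_f a t
  have := ConfObj.resF_preservesEpimorphisms (D := D) (Set.Iic α)
  let _ : HasDerivedCategory.{w} ((D.restrict (Set.Iic α)).C ⟨α, Set.mem_Iic.mpr (le_refl α)⟩) :=
    ‹HasDerivedCategory.{w} (D.C α)›
  obtain ⟨E, hE⟩ := exists_Db_full_faithful adj₁ adj₂
  exact ⟨i, j, E, ⟨adj₁⟩, ⟨adj₂⟩, hE⟩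

end PosetDiagram

/-- **Statement 11** (Corollary 3.7): let `X/S` be a smooth configuration scheme and
`α ∈ S`.  With `i : {α} ↪ U_α` the closed and `j : U_α ↪ S` the open embedding, the
composition `j_! ∘ i_* : D^b(coh(X(α))) ⥤ D^b(coh(X/S))` is fully faithful; in particular
`D^b(coh(X(α)))` is naturally a full subcategory of `D^b(coh(X/S))`. -/
theorem Db_coh_stratum_fully_faithful
    (S : Type) [PartialOrder S] [Fintype S]
    (CS : ConfigScheme S) (hsm : CS.Smooth) (SD : SheafData.{v, u}) (α : S)
    [Abelian (cohConf CS SD)]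
    [Abelian (ConfObj ((CS.diagram SD).restrict (Set.Iic α)))]
    [HasDerivedCategory.{w} (cohConf CS SD)]
    [HasDerivedCategory.{w} (ConfObj ((CS.diagram SD).restrict (Set.Iic α)))]
    [HasDerivedCategory.{w} (SD.coh (CS.X α))] :
    ∃ (i₀ : SD.coh (CS.X α) ⥤ ConfObj ((CS.diagram SD).restrict (Set.Iic α)))
      (j₀ : ConfObj ((CS.diagram SD).restrict (Set.Iic α)) ⥤ cohConf CS SD)
      (E : Db (SD.coh (CS.X α)) ⥤ Db (cohConf CS SD)),
      -- `i₀` is the extension by zero onto the closed point `α` of `U_α`,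
      -- i.e. the right adjoint of the evaluation `i^*` at `α`:
      Nonempty (evalF ((CS.diagram SD).restrict (Set.Iic α))
        ⟨α, Set.mem_Iic.mpr (le_refl α)⟩ ⊣ i₀) ∧
      -- `j₀` is the extension by zero from the open subset `U_α`,
      -- i.e. the left adjoint of the restriction `j^*`:
      Nonempty (j₀ ⊣ resF (CS.diagram SD) (Set.Iic α)) ∧
      -- `E` is induced by `j₀ ∘ i₀` on bounded derived categories, and is fully faithful:
      Nonempty (toDb (SD.coh (CS.X α)) ⋙ E ≅ (i₀ ⋙ j₀) ⋙ toDb (cohConf CS SD)) ∧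
      E.Full ∧ E.Faithful := by
  let (β : S) : Abelian ((CS.diagram SD).C β) := SD.ab (CS.X β)
  have {β γ : S} (h : γ ≤ β) : ((CS.diagram SD).φ h).Additive := SD.pull_additive (CS.f h)
  have {β γ : S} (h : γ ≤ β) : PreservesFiniteColimits ((CS.diagram SD).φ h) :=
    SD.pull_rightExact (CS.f h)
  let _ : HasDerivedCategory.{w} ((CS.diagram SD).C α) :=
    ‹HasDerivedCategory.{w} (SD.coh (CS.X α))›
  exact (CS.diagram SD).exists_Db_stratum α
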